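/- Improved expressiveness for general neural networks: suppose the index set {1, …, L} can be split into two (possibly empty) disjoint subsets I and J such that: (i) for each i ∈ I, the activation function σ_i is continuous, the limits σ_i(−∞) := lim_{s → −∞} σ_i(s) and σ_i(∞) := lim_{s → ∞} σ_i(s) exist in ℝ, and σ_i(−∞) ≠ σ_i(∞); (ii) for each i ∈ J, the function σ̃_i(s) := σ_i(s) − σ_i(s − 1) is continuous, has limits σ̃_i(−∞), σ̃_i(∞) existing in ℝ with σ̃_i(−∞) ≠ σ̃_i(∞), and w_i ≥ 2 for all i ∈ J; (iii) w₁ ≥ 2 in the case 1 ∈ I and w₁ ≥ 4 in the case 1 ∈ J. Then for every y_d ∈ Y with y_d ≠ 0 one has inf_{α ∈ D} ‖Ψ(α) − y_d‖_Y² < ‖y_d‖_Y², and moreover Θ(Ψ) ≤ 1 − 1/n. -/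

import Mathlib

noncomputable section

/-- The norm `‖y‖_Y = ((1/(2n)) · Σ_k ‖y_k‖₂²)^{1/2}` on `Y = (ℝ^{d_y})^n`. -/
def normY {dy n : ℕ} (y : Fin n → Fin dy → ℝ) : ℝ :=
  Real.sqrt (1 / (2 * (n : ℝ)) * ∑ k, ∑ j, y k j ^ 2)

/-- Output of the `i`-th hidden layer of a fully connected feedforward network with widths
`w`, activation functions `σ` (layer `i` uses `σ i`, applied componentwise), weight matrices
`A i : ℝ^{w (i+1) × w i}` and biases `b i : ℝ^{w (i+1)}` (the data of layer `i + 1`). -/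
def hiddenNN (w : ℕ → ℕ) (σ : ℕ → ℝ → ℝ)
    (A : (i : ℕ) → Fin (w (i + 1)) → Fin (w i) → ℝ)
    (b : (i : ℕ) → Fin (w (i + 1)) → ℝ) :
    (i : ℕ) → (Fin (w 0) → ℝ) → Fin (w i) → ℝ
  | 0 => fun z => z
  | i + 1 => fun z j => σ (i + 1) ((∑ k, A i j k * hiddenNN w σ A b i z k) + b i j)

/-- The network `ψ(α, ·) : ℝ^{w 0} → ℝ^{w (L+1)}` with `L` (activated) hidden layers and an
affine output layer. -/
def netNN (w : ℕ → ℕ) (L : ℕ) (σ : ℕ → ℝ → ℝ)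
    (A : (i : ℕ) → Fin (w (i + 1)) → Fin (w i) → ℝ)
    (b : (i : ℕ) → Fin (w (i + 1)) → ℝ)
    (z : Fin (w 0) → ℝ) : Fin (w (L + 1)) → ℝ :=
  fun j => (∑ k, A L j k * hiddenNN w σ A b L z k) + b L j

/-- The optimal value of the squared loss over all network parameters. -/
def lossInfNN (w : ℕ → ℕ) (L n : ℕ) (σ : ℕ → ℝ → ℝ)
    (x : Fin n → Fin (w 0) → ℝ) (y : Fin n → Fin (w (L + 1)) → ℝ) : ℝ :=
  sInf {r : ℝ | ∃ (A : (i : ℕ) → Fin (w (i + 1)) → Fin (w i) → ℝ)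
      (b : (i : ℕ) → Fin (w (i + 1)) → ℝ),
      r = normY ((fun k => netNN w L σ A b (x k)) - y) ^ 2}

/-- The worst-case error bound `Θ(Ψ)` of the network over unit label vectors. -/
def ThetaNN (w : ℕ → ℕ) (L n : ℕ) (σ : ℕ → ℝ → ℝ)
    (x : Fin n → Fin (w 0) → ℝ) : ℝ :=
  sSup {t : ℝ | ∃ y : Fin n → Fin (w (L + 1)) → ℝ, normY y = 1 ∧ t = lossInfNN w L n σ x y}

open Filter Topology

/-- The output of layer `i` depends only on the parameters of the layers up to `i`. -/
lemma hiddenNN_congr {w : ℕ → ℕ} {σ : ℕ → ℝ → ℝ}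
    {A A' : (i : ℕ) → Fin (w (i + 1)) → Fin (w i) → ℝ}
    {b b' : (i : ℕ) → Fin (w (i + 1)) → ℝ} {i : ℕ}
    (hA : ∀ j < i, A j = A' j) (hb : ∀ j < i, b j = b' j) (z : Fin (w 0) → ℝ) :
    hiddenNN w σ A b i z = hiddenNN w σ A' b' i z := by
  induction i with
  | zero => rfl
  | succ i ih =>
    funext j
    simp only [hiddenNN, hA i i.lt_succ_self, hb i i.lt_succ_self,
      ih (fun j hj => hA j (by omega)) (fun j hj => hb j (by omega))]

/-- The vectors of values at the inputs `x` of affine functionals of the output of layer `i`. -/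
def affineFeatures (w : ℕ → ℕ) (σ : ℕ → ℝ → ℝ) {n : ℕ} (x : Fin n → Fin (w 0) → ℝ) (i : ℕ) :
    Set (Fin n → ℝ) :=
  {g | ∃ (A : (i : ℕ) → Fin (w (i + 1)) → Fin (w i) → ℝ) (b : (i : ℕ) → Fin (w (i + 1)) → ℝ)
    (u : Fin (w i) → ℝ) (c : ℝ), ∀ m, g m = (∑ k, u k * hiddenNN w σ A b i (x m) k) + c}

/-- Affine reparametrizations of one feature, fed into at most `w (i + 1)` neurons of the next
layer and recombined affinely, give a feature of that layer. -/
lemma affineFeatures_succ {w : ℕ → ℕ} {σ : ℕ → ℝ → ℝ} {n : ℕ} {x : Fin n → Fin (w 0) → ℝ}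
    {i : ℕ} {g : Fin n → ℝ} (hg : g ∈ affineFeatures w σ x i)
    {ι : Type*} [Fintype ι] (hι : Fintype.card ι ≤ w (i + 1)) (p q r : ι → ℝ) (d : ℝ) :
    (fun m => (∑ j, r j * σ (i + 1) (p j * g m + q j)) + d) ∈ affineFeatures w σ x (i + 1) := by
  classical
  obtain ⟨A, b, u, c, hg⟩ := hg
  obtain ⟨e⟩ : Nonempty (ι ↪ Fin (w (i + 1))) :=
    Function.Embedding.nonempty_of_card_le (by simpa using hι)
  set P := Function.extend e p 0 with hP
  set Q := Function.extend e q 0 with hQ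
  refine ⟨Function.update A i fun j k => P j * u k,
    Function.update b i fun j => P j * c + Q j, Function.extend e r 0, d, fun m => ?_⟩
  have hid := hiddenNN_congr (w := w) (σ := σ) (A := Function.update A i fun j k => P j * u k)
    (A' := A) (b := Function.update b i fun j => P j * c + Q j) (b' := b) (i := i)
    (fun j hj => Function.update_of_ne hj.ne _ _) (fun j hj => Function.update_of_ne hj.ne _ _)
    (x m)
  have hlin : ∀ j, (∑ k, P j * u k * hiddenNN w σ A b i (x m) k) + (P j * c + Q j)
      = P j * g m + Q j := fun j => by
    simp only [hg m, mul_assoc, ← Finset.mul_sum]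
    ring
  simp only [hiddenNN, hid, Function.update_self, hlin]
  congr 1
  rw [← Finset.sum_subset (Finset.subset_univ (Finset.univ.map e)), Finset.sum_map]
  · simp [hP, hQ, e.injective.extend_apply]
  · intro j _ hj
    rw [Function.extend_apply' _ _ _ (by simpa using hj)]
    simp

/-- The input features contain a linear functional separating one input from all the others. -/
lemma exists_mem_affineFeatures_zero_forall_ne {w : ℕ → ℕ} (σ : ℕ → ℝ → ℝ) {n : ℕ}
    {x : Fin n → Fin (w 0) → ℝ} (hx : Function.Injective x) (k : Fin n) :
    ∃ s ∈ affineFeatures w σ x 0, ∀ m ≠ k, s m ≠ s k := by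
  obtain ⟨f, hf⟩ := Module.exists_dual_forall_apply_ne_zero (K := ℝ)
    (fun m : {m // m ≠ k} => x m - x k) fun m => sub_ne_zero.2 fun h => m.2 (hx h)
  refine ⟨fun m => f (x m), ⟨0, 0, fun j => f (Pi.single j 1), 0, fun m => ?_⟩, fun m hm h => ?_⟩
  · refine (LinearMap.pi_apply_eq_sum_univ f (x m)).trans ?_
    simp only [hiddenNN, add_zero, smul_eq_mul]
    refine Finset.sum_congr rfl fun j _ => ?_
    rw [mul_comm]
    congr 2
    ext l
    simp [Pi.single_apply, eq_comm]
  · exact hf ⟨m, hm⟩ (by simpa [sub_eq_zero] using h)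

/-- A linear combination of at most `N` translates of `τ` is continuous with distinct limits
at `±∞`. -/
def HasSigmoidalCombination (τ : ℝ → ℝ) (N : ℕ) : Prop :=
  ∃ c t : Fin N → ℝ, Continuous (fun s => ∑ j, c j * τ (s + t j)) ∧ ∃ a b : ℝ, a ≠ b ∧
    Tendsto (fun s => ∑ j, c j * τ (s + t j)) atBot (𝓝 a) ∧
    Tendsto (fun s => ∑ j, c j * τ (s + t j)) atTop (𝓝 b)

/-- Differences of rescaled sigmoidal functions tend to the indicator of a point. -/
lemma tendsto_sigmoidal_difference {ρ : ℝ → ℝ} {a b : ℝ} (ha : Tendsto ρ atBot (𝓝 a))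
    (hb : Tendsto ρ atTop (𝓝 b)) (hab : a ≠ b) {ε s : ℝ} (hε : 0 < ε) (hs : s = 0 ∨ ε < |s|) :
    Tendsto (fun N : ℝ => (b - a)⁻¹ * (ρ (N * (s + ε)) - ρ (N * (s - ε)))) atTop
      (𝓝 (if s = 0 then 1 else 0)) := by
  have hba : b - a ≠ 0 := sub_ne_zero.2 hab.symm
  have pos : ∀ {r : ℝ}, 0 < r → Tendsto (fun N : ℝ => ρ (N * r)) atTop (𝓝 b) :=
    fun hr => hb.comp (tendsto_id.atTop_mul_const hr)
  have neg : ∀ {r : ℝ}, r < 0 → Tendsto (fun N : ℝ => ρ (N * r)) atTop (𝓝 a) :=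
    fun hr => ha.comp (tendsto_id.atTop_mul_const_of_neg hr)
  rcases hs with rfl | hs
  · simpa [hba] using
      ((pos (r := 0 + ε) (by linarith)).sub (neg (r := 0 - ε) (by linarith))).const_mul (b - a)⁻¹
  · have hs0 : s ≠ 0 := by
      rintro rfl
      simp at hs
      linarith
    rw [if_neg hs0]
    rcases lt_abs.1 hs with h | h
    · simpa using ((pos (r := s + ε) (by linarith)).sub
        (pos (r := s - ε) (by linarith))).const_mul (b - a)⁻¹
    · simpa using ((neg (r := s + ε) (by linarith)).sub
        (neg (r := s - ε) (by linarith))).const_mul (b - a)⁻¹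

/-- The first layer approximates the indicator of any single training input. -/
lemma single_mem_closure_affineFeatures_one {w : ℕ → ℕ} {σ : ℕ → ℝ → ℝ} {n : ℕ}
    {x : Fin n → Fin (w 0) → ℝ} (hx : Function.Injective x) {N : ℕ} (hN : 2 * N ≤ w 1)
    (hσ : HasSigmoidalCombination (σ 1) N) (k : Fin n) :
    Pi.single k 1 ∈ closure (affineFeatures w σ x 1) := by
  obtain ⟨c, t, -, a, b, hab, ha, hb⟩ := hσ
  obtain ⟨s, hs, hsk⟩ := exists_mem_affineFeatures_zero_forall_ne σ hx k
  obtain ⟨ε, hε, hεs⟩ : ∃ ε > 0, ∀ m ≠ k, ε < |s m - s k| := by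
    have hev : ∀ᶠ ε in 𝓝[>] (0 : ℝ), ∀ m, m ≠ k → ε < |s m - s k| := by
      refine eventually_all.2 fun m => ?_
      by_cases hm : m = k
      · simp [hm]
      · filter_upwards [nhdsWithin_le_nhds
          (eventually_lt_nhds (abs_pos.2 (sub_ne_zero.2 (hsk m hm))))] with ε h _ using h
    obtain ⟨ε, h, hε⟩ := (hev.and self_mem_nhdsWithin).exists
    exact ⟨ε, hε, h⟩
  set ρ : ℝ → ℝ := fun s => ∑ j, c j * σ 1 (s + t j) with hρ
  refine mem_closure_of_tendsto (b := atTop)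
    (f := fun R : ℝ => fun m =>
      (b - a)⁻¹ * (ρ (R * (s m - s k + ε)) - ρ (R * (s m - s k - ε))))
    (tendsto_pi_nhds.2 fun m => ?_) (Eventually.of_forall fun R => ?_)
  · have h := tendsto_sigmoidal_difference (s := s m - s k) ha hb hab hε (by
      by_cases hm : m = k
      · simp [hm]
      · exact Or.inr (hεs m hm))
    convert h using 2
    by_cases hm : m = k
    · simp [hm]
    · simp [hm, sub_eq_zero, hsk m hm]
  · convert affineFeatures_succ hs (ι := Fin N ⊕ Fin N) (by simp; omega) (fun _ => R)
      (Sum.elim (fun j => R * (ε - s k) + t j) fun j => R * (-ε - s k) + t j)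
      (Sum.elim (fun j => (b - a)⁻¹ * c j) fun j => -((b - a)⁻¹ * c j)) 0 using 2 with m
    simp only [hρ, Fintype.sum_sum_type, Sum.elim_inl, Sum.elim_inr, add_zero, mul_sub,
      Finset.mul_sum, neg_mul, Finset.sum_neg_distrib, ← sub_eq_add_neg, mul_assoc]
    congr 1 <;> refine Finset.sum_congr rfl fun j _ => ?_ <;> ring_nf

/-- Approximability of an indicator is inherited by the next layer. -/
lemma single_mem_closure_affineFeatures_succ {w : ℕ → ℕ} {σ : ℕ → ℝ → ℝ} {n : ℕ}
    {x : Fin n → Fin (w 0) → ℝ} {i N : ℕ} (hN : N ≤ w (i + 1))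
    (hσ : HasSigmoidalCombination (σ (i + 1)) N) {k : Fin n}
    (hk : Pi.single k 1 ∈ closure (affineFeatures w σ x i)) :
    Pi.single k 1 ∈ closure (affineFeatures w σ x (i + 1)) := by
  obtain ⟨c, t, hcont, a, b, hab, ha, hb⟩ := hσ
  set ρ : ℝ → ℝ := fun s => ∑ j, c j * σ (i + 1) (s + t j) with hρ
  obtain ⟨s₀, s₁, hs⟩ : ∃ s₀ s₁, ρ s₀ ≠ ρ s₁ := by
    by_contra! h
    have hconst : ρ = fun _ => ρ 0 := funext fun s => h s 0
    rw [hconst] at ha hb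
    exact hab ((tendsto_nhds_unique ha tendsto_const_nhds).trans
      (tendsto_nhds_unique tendsto_const_nhds hb))
  have hd : ρ s₁ - ρ s₀ ≠ 0 := sub_ne_zero.2 hs.symm
  let T : (Fin n → ℝ) → Fin n → ℝ := fun g m =>
    (ρ s₁ - ρ s₀)⁻¹ * ρ ((s₁ - s₀) * g m + s₀) + -((ρ s₁ - ρ s₀)⁻¹ * ρ s₀)
  have hT : Continuous T := continuous_pi fun m =>
    ((hcont.comp (by fun_prop)).const_mul _).add continuous_const
  have hTk : T (Pi.single k 1) = Pi.single k 1 := by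
    funext m
    by_cases hm : m = k
    · subst hm
      simp only [T, Pi.single_eq_same]
      rw [show (s₁ - s₀) * 1 + s₀ = s₁ by ring]
      field_simp
      ring
    · simp [T, hm]
  rw [← hTk]
  refine map_mem_closure hT hk fun g hg => ?_
  convert affineFeatures_succ hg (ι := Fin N) (by simpa using hN) (fun _ => s₁ - s₀)
    (fun j => s₀ + t j) (fun j => (ρ s₁ - ρ s₀)⁻¹ * c j) (-((ρ s₁ - ρ s₀)⁻¹ * ρ s₀)) using 2 with m
  simp only [T, hρ, Finset.mul_sum, mul_assoc, add_assoc]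

lemma normY_sq {dy n : ℕ} (y : Fin n → Fin dy → ℝ) :
    normY y ^ 2 = 1 / (2 * (n : ℝ)) * ∑ k, ∑ j, y k j ^ 2 :=
  Real.sq_sqrt (by positivity)

/-- If the last hidden layer approximates the indicator of the `k`-th input, the `k`-th label can
be fitted at no cost elsewhere. -/
lemma lossInfNN_le_of_single_mem_closure {w : ℕ → ℕ} {L n : ℕ} {σ : ℕ → ℝ → ℝ}
    {x : Fin n → Fin (w 0) → ℝ} {k : Fin n}
    (hk : Pi.single k 1 ∈ closure (affineFeatures w σ x L)) (y : Fin n → Fin (w (L + 1)) → ℝ) :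
    lossInfNN w L n σ x y ≤ normY y ^ 2 - 1 / (2 * (n : ℝ)) * ∑ j, y k j ^ 2 := by
  let F : (Fin n → ℝ) → ℝ := fun g => normY ((fun m j => y k j * g m) - y) ^ 2
  have hF : Continuous F := by
    simp only [F, normY_sq, Pi.sub_apply]
    fun_prop
  have hsub : affineFeatures w σ x L ⊆ {g | lossInfNN w L n σ x y ≤ F g} := by
    rintro g ⟨A, b, u, c, hg⟩
    refine csInf_le (a := F g) ⟨0, ?_⟩ ⟨Function.update A L fun j l => y k j * u l,
      Function.update b L fun j => y k j * c, ?_⟩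
    · rintro _ ⟨A, b, rfl⟩
      positivity
    · simp only [F]
      congr 3
      funext m j
      simp only [netNN, Function.update_self]
      rw [hiddenNN_congr (A' := A) (b' := b) (fun j hj => Function.update_of_ne hj.ne _ _)
        (fun j hj => Function.update_of_ne hj.ne _ _), hg m]
      simp only [mul_add, Finset.mul_sum, mul_assoc]
  refine (closure_minimal hsub (isClosed_le continuous_const hF) hk).trans_eq ?_
  simp only [F, normY_sq, ← mul_sub, Pi.sub_apply]
  congr 1
  rw [← Finset.add_sum_erase _ _ (Finset.mem_univ k),
    ← Finset.add_sum_erase (a := k) _ (fun m => ∑ j, y m j ^ 2) (Finset.mem_univ k)]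
  simp only [Pi.single_eq_same, mul_one, sub_self]
  rw [add_sub_cancel_left]
  simp only [ne_eq, OfNat.ofNat_ne_zero, not_false_eq_true, zero_pow, Finset.sum_const_zero,
    zero_add]
  refine Finset.sum_congr rfl fun m hm => ?_
  simp [Pi.single_eq_of_ne (Finset.ne_of_mem_erase hm)]

theorem general_network_expressiveness
    (L n : ℕ) (hL : 1 ≤ L) (hn : 2 ≤ n)
    (w : ℕ → ℕ) (hw : ∀ i, 1 ≤ w i)
    (σ : ℕ → ℝ → ℝ)
    (x : Fin n → Fin (w 0) → ℝ) (hx : Function.Injective x)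
    (I J : Set ℕ) (hIJ : I ∪ J = Set.Icc 1 L) (hdisj : Disjoint I J)
    (hI : ∀ i ∈ I, Continuous (σ i) ∧ ∃ a b : ℝ, a ≠ b ∧
      Filter.Tendsto (σ i) Filter.atBot (nhds a) ∧
      Filter.Tendsto (σ i) Filter.atTop (nhds b))
    (hJ : ∀ i ∈ J, 2 ≤ w i ∧ Continuous (fun s => σ i s - σ i (s - 1)) ∧
      ∃ a b : ℝ, a ≠ b ∧
        Filter.Tendsto (fun s => σ i s - σ i (s - 1)) Filter.atBot (nhds a) ∧
        Filter.Tendsto (fun s => σ i s - σ i (s - 1)) Filter.atTop (nhds b))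
    (hw1I : 1 ∈ I → 2 ≤ w 1) (hw1J : 1 ∈ J → 4 ≤ w 1) :
    (∀ y : Fin n → Fin (w (L + 1)) → ℝ, y ≠ 0 →
      lossInfNN w L n σ x y < normY y ^ 2) ∧
    ThetaNN w L n σ x ≤ 1 - 1 / (n : ℝ) := by
  have hcomb : ∀ i ∈ Set.Icc 1 L, ∃ N, N ≤ w i ∧ (i = 1 → 2 * N ≤ w 1) ∧
      HasSigmoidalCombination (σ i) N := by
    intro i hi
    rw [← hIJ] at hi
    rcases hi with hi | hi
    · refine ⟨1, hw i, fun h => hw1I (h ▸ hi), ![1], ![0], ?_⟩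
      simpa using hI i hi
    · obtain ⟨hwi, h⟩ := hJ i hi
      refine ⟨2, hwi, fun h => hw1J (h ▸ hi), ![1, -1], ![0, -1], ?_⟩
      simpa [Fin.sum_univ_two, ← sub_eq_add_neg] using h
  have hsingle : ∀ k : Fin n, Pi.single k 1 ∈ closure (affineFeatures w σ x L) := by
    intro k
    have haux : ∀ i, 1 ≤ i → i ≤ L → Pi.single k 1 ∈ closure (affineFeatures w σ x i) := by
      intro i hi
      induction i, hi using Nat.le_induction with
      | base =>
        intro h
        obtain ⟨N, -, hN, hσ⟩ := hcomb 1 ⟨le_rfl, h⟩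
        exact single_mem_closure_affineFeatures_one hx (hN rfl) hσ k
      | succ i hi ih =>
        intro h
        obtain ⟨N, hN, -, hσ⟩ := hcomb (i + 1) ⟨by omega, h⟩
        exact single_mem_closure_affineFeatures_succ hN hσ (ih (by omega))
    exact haux L hL le_rfl
  have hn0 : (0 : ℝ) < n := by exact_mod_cast (by omega : 0 < n)
  have hbound : ∀ y : Fin n → Fin (w (L + 1)) → ℝ,
      lossInfNN w L n σ x y ≤ (1 - 1 / (n : ℝ)) * normY y ^ 2 := by
    intro y
    have : Nonempty (Fin n) := ⟨⟨0, by omega⟩⟩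
    obtain ⟨k, hk⟩ := Finite.exists_max fun m => ∑ j, y m j ^ 2
    have hsum : ∑ m, ∑ j, y m j ^ 2 ≤ n * ∑ j, y k j ^ 2 := by
      simpa using Finset.sum_le_card_nsmul Finset.univ _ _ fun m _ => hk m
    refine (lossInfNN_le_of_single_mem_closure (hsingle k) y).trans ?_
    rw [sub_mul, one_mul]
    refine sub_le_sub_left ?_ _
    rw [normY_sq, mul_left_comm]
    refine mul_le_mul_of_nonneg_left ?_ (by positivity)
    rw [one_div, inv_mul_le_iff₀ hn0]
    exact hsum
  refine ⟨fun y hy => (hbound y).trans_lt ?_, Real.sSup_le ?_ ?_⟩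
  · have hpos : 0 < normY y ^ 2 := by
      obtain ⟨k, hk⟩ := Function.ne_iff.1 hy
      obtain ⟨j, hj⟩ := Function.ne_iff.1 hk
      rw [normY_sq]
      refine mul_pos (by positivity) ?_
      refine Finset.sum_pos' (fun m _ => by positivity) ⟨k, Finset.mem_univ k, ?_⟩
      exact Finset.sum_pos' (fun l _ => by positivity)
        ⟨j, Finset.mem_univ j, by simpa [sq_pos_iff] using hj⟩
    have : 0 < 1 / (n : ℝ) := by positivity
    nlinarith
  · rintro _ ⟨y, hy, rfl⟩
    simpa [hy] using hbound y
  · rw [sub_nonneg, div_le_one hn0]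
    exact_mod_cast (by omega : 1 ≤ n)
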